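/- arXiv:1912.09337 — 3 statements merged into one kernel-verified Lean document; each statement's English description precedes it below -/
import Mathlib

section
/- (Γ-convergence, limsup inequality.) Suppose W satisfies (W0), (W1) and (W3). For any ρ ∈ P_c(ℝ) there exists a family {ρ_δ}_{δ>0} ⊂ P_c(ℝ) such that ρ_δ converges weakly to ρ as δ → 0 and limsup_{δ→0} E_δ(ρ_δ) ≤ E(ρ). One may take ρ_δ = φ_δ ∗ ρ, where φ_δ(x) = δ^{−1/2} φ(x/√δ) with φ(x) = (4π)^{−1/2} exp(−|x|²/4) the one-dimensional heat kernel. -/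
open MeasureTheory Filter Topology

/-- The convolution `(W ∗ ρ)(x) = ∫ W(x - w) ρ(w) dw`. -/
noncomputable def Wconv (W ρ : ℝ → ℝ) (x : ℝ) : ℝ := ∫ w, W (x - w) * ρ w

/-- `P_c(ℝ)`: nonnegative integrable densities of unit mass. -/
def Pc (ρ : ℝ → ℝ) : Prop :=
  (∀ x, 0 ≤ ρ x) ∧ MeasureTheory.Integrable ρ ∧ (∫ x, ρ x) = 1

/-- The regularised interaction energy
`E_δ(ρ) = (1/2) ∫ ρ (W ∗ ρ + δ ρ) dx`; `δ = 0` gives the non-regularised energy `E`. -/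
noncomputable def Ereg (W : ℝ → ℝ) (δ : ℝ) (ρ : ℝ → ℝ) : ℝ :=
  (1 / 2) * ∫ x, ρ x * (Wconv W ρ x + δ * ρ x)

/-- The one-dimensional heat kernel `φ(x) = (4π)^{-1/2} exp(-|x|²/4)`. -/
noncomputable def heatPhi (x : ℝ) : ℝ := (Real.sqrt (4 * Real.pi))⁻¹ * Real.exp (-(|x| ^ 2) / 4)

/-- The rescaled heat kernel `φ_δ(x) = δ^{-1/2} φ(x/√δ)`. -/
noncomputable def heatPhiδ (δ x : ℝ) : ℝ := (Real.sqrt δ)⁻¹ * heatPhi (x / Real.sqrt δ)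

theorem heatPhi_eq_gaussianPDFReal :
    heatPhi = ProbabilityTheory.gaussianPDFReal 0 2 := by
  funext x
  rw [ProbabilityTheory.gaussianPDFReal, heatPhi]
  rw [NNReal.coe_ofNat, sub_zero, sq_abs, show 2 * Real.pi * 2 = 4 * Real.pi by ring,
    show (2 * 2 : ℝ) = 4 by norm_num]

theorem heatPhi_nonneg (x : ℝ) : 0 ≤ heatPhi x := by
  unfold heatPhi
  positivity

theorem integrable_heatPhi : Integrable heatPhi := by
  rw [heatPhi_eq_gaussianPDFReal]
  exact ProbabilityTheory.integrable_gaussianPDFReal 0 2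

theorem integral_heatPhi : ∫ x, heatPhi x = 1 := by
  rw [heatPhi_eq_gaussianPDFReal]
  exact ProbabilityTheory.integral_gaussianPDFReal_eq_one 0 (by norm_num)

theorem heatPhi_le (x : ℝ) : heatPhi x ≤ (Real.sqrt (4 * Real.pi))⁻¹ := by
  unfold heatPhi
  refine mul_le_of_le_one_right (by positivity) (Real.exp_le_one_iff.2 ?_)
  have : 0 ≤ |x| ^ 2 := by positivity
  linarith

theorem integrable_heatPhi_mul_abs : Integrable fun x => heatPhi x * |x| := by
  have h := (integrable_mul_exp_neg_mul_sq (b := 1 / 4) (by norm_num)).norm.const_mul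
    (Real.sqrt (4 * Real.pi))⁻¹
  refine h.congr (Eventually.of_forall fun x => ?_)
  simp only [heatPhi, norm_mul, Real.norm_eq_abs, Real.abs_exp, sq_abs]
  ring_nf

theorem heatPhiδ_nonneg (δ x : ℝ) : 0 ≤ heatPhiδ δ x :=
  mul_nonneg (by positivity) (heatPhi_nonneg _)

theorem integrable_heatPhiδ {δ : ℝ} (hδ : 0 < δ) : Integrable (heatPhiδ δ) :=
  (integrable_heatPhi.comp_div (Real.sqrt_pos.2 hδ).ne').const_mul _

theorem integral_heatPhiδ_mul {δ : ℝ} (hδ : 0 < δ) (h : ℝ → ℝ) :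
    ∫ z, heatPhiδ δ z * h z = ∫ u, heatPhi u * h (Real.sqrt δ * u) := by
  have hs := Real.sqrt_pos.2 hδ
  have := Measure.integral_comp_div (fun u => heatPhi u * h (Real.sqrt δ * u)) (Real.sqrt δ)
  simp only [mul_div_cancel₀ _ hs.ne', abs_of_pos hs, smul_eq_mul] at this
  simp only [heatPhiδ, mul_assoc]
  rw [integral_const_mul, this, inv_mul_cancel_left₀ hs.ne']

theorem integrable_prod_kernel {k ρ : ℝ → ℝ} (hk : Integrable k) (hρ : Integrable ρ) :
    Integrable (fun p : ℝ × ℝ => k (p.1 - p.2) * ρ p.2) (volume.prod volume) := by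
  have := hρ.convolution_integrand (ContinuousLinearMap.mul ℝ ℝ) hk
  simpa [mul_comm] using this

theorem integral_mul_conv {k ρ g : ℝ → ℝ} (hk : Integrable k) (hρ : Integrable ρ)
    (hg : Continuous g) {C : ℝ} (hC : ∀ x, |g x| ≤ C) :
    ∫ x, g x * ∫ w, k (x - w) * ρ w = ∫ w, ρ w * ∫ z, k z * g (w + z) := by
  have hi : Integrable (fun p : ℝ × ℝ => g p.1 * (k (p.1 - p.2) * ρ p.2))
      (volume.prod volume) :=
    (integrable_prod_kernel hk hρ).bdd_mul
      (hg.comp continuous_fst).aestronglyMeasurable (Eventually.of_forall fun p => hC p.1)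
  calc ∫ x, g x * ∫ w, k (x - w) * ρ w
      = ∫ x, ∫ w, g x * (k (x - w) * ρ w) := by simp only [integral_const_mul]
    _ = ∫ w, ∫ x, g x * (k (x - w) * ρ w) := integral_integral_swap hi
    _ = ∫ w, ρ w * ∫ z, k z * g (w + z) := by
      congr 1
      ext w
      rw [← integral_const_mul, ← integral_add_right_eq_self _ w]
      congr 1
      ext z
      rw [add_sub_cancel_right, add_comm z w]
      ring

/-- The heat-kernel mollification of `ρ` at scale `√δ`. -/
noncomputable def heatConv (ρ : ℝ → ℝ) (δ x : ℝ) : ℝ := ∫ w, heatPhiδ δ (x - w) * ρ w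

theorem integral_mul_heatConv {ρ g : ℝ → ℝ} {δ : ℝ} (hδ : 0 < δ) (hρ : Integrable ρ)
    (hg : Continuous g) {C : ℝ} (hC : ∀ x, |g x| ≤ C) :
    ∫ x, g x * heatConv ρ δ x = ∫ w, ρ w * ∫ u, heatPhi u * g (w + Real.sqrt δ * u) := by
  simp only [heatConv]
  rw [integral_mul_conv (integrable_heatPhiδ hδ) hρ hg hC]
  simp only [integral_heatPhiδ_mul hδ fun z => g (_ + z)]

theorem heatConv_nonneg {ρ : ℝ → ℝ} (hρ : ∀ x, 0 ≤ ρ x) (δ x : ℝ) : 0 ≤ heatConv ρ δ x :=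
  integral_nonneg fun w => mul_nonneg (heatPhiδ_nonneg _ _) (hρ w)

theorem pc_heatConv {ρ : ℝ → ℝ} {δ : ℝ} (hδ : 0 < δ) (hρ : Pc ρ) : Pc (heatConv ρ δ) := by
  refine ⟨heatConv_nonneg hρ.1 δ,
    (integrable_prod_kernel (integrable_heatPhiδ hδ) hρ.2.1).integral_prod_left, ?_⟩
  have := integral_mul_heatConv (g := fun _ => 1) (C := 1) hδ hρ.2.1 continuous_const (by simp)
  simpa [integral_heatPhi, hρ.2.2] using this

theorem heatConv_le {ρ : ℝ → ℝ} {δ : ℝ} (hδ : 0 < δ) (hρ : Pc ρ) (x : ℝ) :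
    heatConv ρ δ x ≤ (Real.sqrt δ)⁻¹ * (Real.sqrt (4 * Real.pi))⁻¹ := by
  have hle : ∀ w, heatPhiδ δ (x - w) ≤ (Real.sqrt δ)⁻¹ * (Real.sqrt (4 * Real.pi))⁻¹ := fun w =>
    mul_le_mul_of_nonneg_left (heatPhi_le _) (by positivity)
  calc heatConv ρ δ x
      ≤ ∫ w, ((Real.sqrt δ)⁻¹ * (Real.sqrt (4 * Real.pi))⁻¹) * ρ w :=
        integral_mono_of_nonneg
          (Eventually.of_forall fun w => mul_nonneg (heatPhiδ_nonneg _ _) (hρ.1 w))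
          (hρ.2.1.const_mul _)
          (Eventually.of_forall fun w => mul_le_mul_of_nonneg_right (hle w) (hρ.1 w))
    _ = _ := by rw [integral_const_mul, hρ.2.2, mul_one]

theorem integrable_heatPhi_mul {g : ℝ → ℝ} (hg : Continuous g) {C : ℝ} (hC : ∀ x, |g x| ≤ C) :
    Integrable fun u => heatPhi u * g u :=
  integrable_heatPhi.mul_bdd hg.aestronglyMeasurable (Eventually.of_forall hC)

theorem continuous_heatAverage {g : ℝ → ℝ} (hg : Continuous g) {C : ℝ} (hC : ∀ x, |g x| ≤ C) :
    Continuous fun p : ℝ × ℝ => ∫ u, heatPhi u * g (p.1 + p.2 * u) := by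
  refine continuous_of_dominated (bound := fun u => heatPhi u * C) (fun p => ?_) (fun p => ?_)
    (integrable_heatPhi.mul_const C) ?_
  · exact (integrable_heatPhi_mul (by fun_prop) fun u => hC _).aestronglyMeasurable
  · refine Eventually.of_forall fun u => ?_
    rw [norm_mul, Real.norm_of_nonneg (heatPhi_nonneg u)]
    exact mul_le_mul_of_nonneg_left (hC _) (heatPhi_nonneg u)
  · exact Eventually.of_forall fun u => by fun_prop

theorem abs_heatAverage_le {g : ℝ → ℝ} {C : ℝ} (hC : ∀ x, |g x| ≤ C) (w s : ℝ) :
    |∫ u, heatPhi u * g (w + s * u)| ≤ C := by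
  have h := norm_integral_le_of_norm_le (f := fun u => heatPhi u * g (w + s * u))
    (integrable_heatPhi.mul_const C) (Eventually.of_forall fun u => by
      rw [norm_mul, Real.norm_of_nonneg (heatPhi_nonneg u)]
      exact mul_le_mul_of_nonneg_left (hC _) (heatPhi_nonneg u))
  rwa [integral_mul_const, integral_heatPhi, one_mul] at h

theorem tendsto_integral_mul_heatConv {ρ g : ℝ → ℝ} (hρ : Integrable ρ)
    (hg : Continuous g) {C : ℝ} (hC : ∀ x, |g x| ≤ C) :
    Tendsto (fun δ => ∫ x, g x * heatConv ρ δ x) (𝓝[>] (0 : ℝ)) (𝓝 (∫ x, g x * ρ x)) := by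
  have hcont : Continuous fun δ : ℝ => ∫ w, ρ w * ∫ u, heatPhi u * g (w + Real.sqrt δ * u) := by
    have havg := continuous_heatAverage hg hC
    refine continuous_of_dominated (bound := fun w => ‖ρ w‖ * C) (fun δ => ?_) (fun δ => ?_)
      (hρ.norm.mul_const C) (Eventually.of_forall fun w => ?_)
    · exact hρ.aestronglyMeasurable.mul
        (havg.comp (by fun_prop : Continuous fun w : ℝ => (w, Real.sqrt δ))).aestronglyMeasurable
    · refine Eventually.of_forall fun w => ?_
      rw [norm_mul]
      exact mul_le_mul_of_nonneg_left (abs_heatAverage_le hC _ _) (norm_nonneg _)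
    · exact continuous_const.mul
        (havg.comp (by fun_prop : Continuous fun δ : ℝ => (w, Real.sqrt δ)))
  have h0 := (hcont.tendsto 0).mono_left (nhdsWithin_le_nhds (s := Set.Ioi 0))
  simp only [Real.sqrt_zero, zero_mul, add_zero, integral_mul_const, integral_heatPhi,
    one_mul] at h0
  simp only [mul_comm (g _) (ρ _)]
  refine h0.congr' ?_
  filter_upwards [self_mem_nhdsWithin] with δ hδ
  exact (integral_mul_heatConv hδ hρ hg hC).symm

theorem abs_integral_mul_heatConv_sub_le {ρ g : ℝ → ℝ} {δ : ℝ} (hδ : 0 < δ) (hρ : Pc ρ)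
    {K : NNReal} (hg : LipschitzWith K g) {C : ℝ} (hC : ∀ x, |g x| ≤ C) :
    |(∫ x, g x * heatConv ρ δ x) - ∫ x, g x * ρ x|
      ≤ K * Real.sqrt δ * ∫ u, heatPhi u * |u| := by
  have hgc := hg.continuous
  set A : ℝ → ℝ := fun w => ∫ u, heatPhi u * g (w + Real.sqrt δ * u)
  have hAc : Continuous A := (continuous_heatAverage hgc hC).comp
    (by fun_prop : Continuous fun w : ℝ => (w, Real.sqrt δ))
  have hpt : ∀ w, |A w - g w| ≤ K * Real.sqrt δ * ∫ u, heatPhi u * |u| := fun w => by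
    have hsub : A w - g w = ∫ u, (heatPhi u * g (w + Real.sqrt δ * u) - heatPhi u * g w) := by
      rw [integral_sub (integrable_heatPhi_mul (by fun_prop) fun u => hC _)
        (integrable_heatPhi.mul_const _), integral_mul_const, integral_heatPhi, one_mul]
    rw [hsub, ← integral_const_mul, ← Real.norm_eq_abs]
    refine norm_integral_le_of_norm_le (integrable_heatPhi_mul_abs.const_mul _)
      (Eventually.of_forall fun u => ?_)
    have h := hg.dist_le_mul (w + Real.sqrt δ * u) w
    rw [Real.dist_eq, Real.dist_eq, add_sub_cancel_left, abs_mul,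
      abs_of_nonneg (Real.sqrt_nonneg δ)] at h
    rw [← mul_sub, norm_mul, Real.norm_of_nonneg (heatPhi_nonneg u)]
    exact (mul_le_mul_of_nonneg_left h (heatPhi_nonneg u)).trans_eq (by ring)
  have hdiff : (∫ x, g x * heatConv ρ δ x) - ∫ x, g x * ρ x
      = ∫ w, (ρ w * A w - g w * ρ w) := by
    rw [integral_mul_heatConv hδ hρ.2.1 hgc hC, integral_sub]
    · exact hρ.2.1.mul_bdd hAc.aestronglyMeasurable
        (Eventually.of_forall fun w => abs_heatAverage_le hC w _)
    · exact hρ.2.1.bdd_mul hgc.aestronglyMeasurable (Eventually.of_forall hC)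
  have h := norm_integral_le_of_norm_le (f := fun w => ρ w * A w - g w * ρ w)
    (hρ.2.1.mul_const (K * Real.sqrt δ * ∫ u, heatPhi u * |u|))
    (Eventually.of_forall fun w => by
      rw [mul_comm (g w), ← mul_sub, norm_mul, Real.norm_of_nonneg (hρ.1 w)]
      exact mul_le_mul_of_nonneg_left (hpt w) (hρ.1 w))
  rw [hdiff]
  rwa [integral_mul_const, hρ.2.2, one_mul] at h

theorem exists_abs_le_of_deriv_eq_zero {W : ℝ → ℝ} (hW0 : ∀ x, W (-x) = W x)
    (hW1 : ContDiff ℝ 1 W) (hW3 : ∀ x : ℝ, 1 / 2 ≤ |x| → deriv W x = 0) :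
    ∃ C, ∀ x, |W x| ≤ C := by
  have hpos : ∀ x, 1 / 2 < x → W x = W (1 / 2) := fun x hx => by
    obtain ⟨c, hc, h⟩ := exists_deriv_eq_slope W hx hW1.continuous.continuousOn
      (hW1.differentiable one_ne_zero).differentiableOn
    rw [hW3 c (hc.1.le.trans (le_abs_self c)), eq_comm, div_eq_zero_iff] at h
    rcases h with h | h <;> linarith
  have hsupp : HasCompactSupport fun x => W x - W (1 / 2) := by
    refine HasCompactSupport.intro (isCompact_Icc (a := -(1 / 2 : ℝ)) (b := 1 / 2)) fun x hx => ?_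
    rw [Set.mem_Icc, ← abs_le, not_le, lt_abs] at hx
    rcases hx with h | h
    · simp only [hpos x h, sub_self]
    · simp only [← hW0 x, hpos (-x) h, sub_self]
  obtain ⟨C, hC⟩ := hsupp.exists_bound_of_continuous (hW1.continuous.sub continuous_const)
  refine ⟨C + |W (1 / 2)|, fun x => ?_⟩
  have h1 := hC x
  rw [Real.norm_eq_abs] at h1
  have h2 := abs_add_le (W x - W (1 / 2)) (W (1 / 2))
  rw [sub_add_cancel] at h2
  linarith

theorem exists_lipschitzWith_of_deriv_eq_zero {W : ℝ → ℝ} (hW1 : ContDiff ℝ 1 W)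
    (hW3 : ∀ x : ℝ, 1 / 2 ≤ |x| → deriv W x = 0) : ∃ K, LipschitzWith K W := by
  have hsupp : HasCompactSupport (deriv W) := by
    refine HasCompactSupport.intro (isCompact_Icc (a := -(1 / 2 : ℝ)) (b := 1 / 2)) fun x hx => ?_
    rw [Set.mem_Icc, ← abs_le, not_le] at hx
    exact hW3 x hx.le
  obtain ⟨C, hC⟩ := hsupp.exists_bound_of_continuous (hW1.continuous_deriv le_rfl)
  exact ⟨C.toNNReal, lipschitzWith_of_nnnorm_deriv_le (hW1.differentiable one_ne_zero)
    fun x => by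
      rw [← NNReal.coe_le_coe, coe_nnnorm]
      exact (hC x).trans (Real.le_coe_toNNReal C)⟩

theorem continuous_Wconv {W ρ : ℝ → ℝ} (hW : Continuous W) {C : ℝ} (hC : ∀ x, |W x| ≤ C)
    (hρ : Integrable ρ) : Continuous (Wconv W ρ) := by
  unfold Wconv
  refine continuous_of_dominated (bound := fun w => C * ‖ρ w‖) (fun x => ?_) (fun x => ?_)
    (hρ.norm.const_mul C) (Eventually.of_forall fun w => by fun_prop)
  · exact (by fun_prop : Continuous fun w => W (x - w)).aestronglyMeasurable.mul
      hρ.aestronglyMeasurable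
  · refine Eventually.of_forall fun w => ?_
    rw [norm_mul]
    exact mul_le_mul_of_nonneg_right (hC _) (norm_nonneg _)

theorem abs_Wconv_le {W ρ : ℝ → ℝ} {C : ℝ} (hC : ∀ x, |W x| ≤ C) (hρ : Pc ρ) (x : ℝ) :
    |Wconv W ρ x| ≤ C := by
  have h := norm_integral_le_of_norm_le (f := fun w => W (x - w) * ρ w)
    (hρ.2.1.const_mul C) (Eventually.of_forall fun w => by
      rw [norm_mul, Real.norm_of_nonneg (hρ.1 w)]
      exact mul_le_mul_of_nonneg_right (hC _) (hρ.1 w))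
  rwa [integral_const_mul, hρ.2.2, mul_one] at h

theorem Ereg_eq_add {W ρ : ℝ → ℝ} (hW : Continuous W) {C : ℝ} (hC : ∀ x, |W x| ≤ C)
    (hρ : Pc ρ) (hsq : Integrable fun x => ρ x * ρ x) (δ : ℝ) :
    Ereg W δ ρ = (1 / 2) * ((∫ x, Wconv W ρ x * ρ x) + δ * ∫ x, ρ x * ρ x) := by
  rw [Ereg, ← integral_const_mul δ, ← integral_add _ (hsq.const_mul δ)]
  · congr 2
    ext x
    ring
  · exact hρ.2.1.bdd_mul (continuous_Wconv hW hC hρ.2.1).aestronglyMeasurable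
      (Eventually.of_forall (abs_Wconv_le hC hρ))

theorem integrable_heatConv_sq {ρ : ℝ → ℝ} {δ : ℝ} (hδ : 0 < δ) (hρ : Pc ρ) :
    Integrable fun x => heatConv ρ δ x * heatConv ρ δ x := by
  have h := (pc_heatConv hδ hρ).2.1
  refine h.bdd_mul (c := (Real.sqrt δ)⁻¹ * (Real.sqrt (4 * Real.pi))⁻¹)
    h.aestronglyMeasurable (Eventually.of_forall fun x => ?_)
  rw [Real.norm_of_nonneg (heatConv_nonneg hρ.1 δ x)]
  exact heatConv_le hδ hρ x

theorem integral_heatConv_sq_le {ρ : ℝ → ℝ} {δ : ℝ} (hδ : 0 < δ) (hρ : Pc ρ) :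
    δ * ∫ x, heatConv ρ δ x * heatConv ρ δ x ≤ Real.sqrt δ * (Real.sqrt (4 * Real.pi))⁻¹ := by
  have hp := pc_heatConv hδ hρ
  have h : ∫ x, heatConv ρ δ x * heatConv ρ δ x
      ≤ ∫ x, ((Real.sqrt δ)⁻¹ * (Real.sqrt (4 * Real.pi))⁻¹) * heatConv ρ δ x :=
    integral_mono (integrable_heatConv_sq hδ hρ) (hp.2.1.const_mul _) fun x =>
      mul_le_mul_of_nonneg_right (heatConv_le hδ hρ x) (hp.1 x)
  rw [integral_const_mul, hp.2.2, mul_one] at h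
  refine (mul_le_mul_of_nonneg_left h hδ.le).trans_eq ?_
  rw [← mul_assoc, ← div_eq_mul_inv δ, Real.div_sqrt]

theorem tendsto_mul_integral_heatConv_sq {ρ : ℝ → ℝ} (hρ : Pc ρ) :
    Tendsto (fun δ => δ * ∫ x, heatConv ρ δ x * heatConv ρ δ x) (𝓝[>] (0 : ℝ)) (𝓝 0) := by
  have hlim : Tendsto (fun δ : ℝ => Real.sqrt δ * (Real.sqrt (4 * Real.pi))⁻¹)
      (𝓝[>] (0 : ℝ)) (𝓝 0) := by
    have h : Continuous fun δ : ℝ => Real.sqrt δ * (Real.sqrt (4 * Real.pi))⁻¹ := by fun_prop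
    simpa using (h.tendsto 0).mono_left (nhdsWithin_le_nhds (s := Set.Ioi 0))
  refine squeeze_zero' ?_ ?_ hlim
  · filter_upwards [self_mem_nhdsWithin] with δ hδ
    exact mul_nonneg (le_of_lt hδ) (integral_nonneg fun x => mul_self_nonneg _)
  · filter_upwards [self_mem_nhdsWithin] with δ hδ
    exact integral_heatConv_sq_le hδ hρ

theorem tendsto_integral_Wconv_heatConv {W ρ : ℝ → ℝ} {K : NNReal} (hK : LipschitzWith K W)
    {C : ℝ} (hC : ∀ x, |W x| ≤ C) (hρ : Pc ρ) :
    Tendsto (fun δ => ∫ x, Wconv W (heatConv ρ δ) x * heatConv ρ δ x) (𝓝[>] (0 : ℝ))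
      (𝓝 (∫ x, Wconv W ρ x * ρ x)) := by
  have hW := hK.continuous
  have hlim := tendsto_integral_mul_heatConv hρ.2.1 (continuous_Wconv hW hC hρ.2.1)
    (abs_Wconv_le hC hρ)
  refine hlim.congr_dist ?_
  have hzero : Tendsto (fun δ : ℝ => K * Real.sqrt δ * ∫ u, heatPhi u * |u|)
      (𝓝[>] (0 : ℝ)) (𝓝 0) := by
    have h : Continuous fun δ : ℝ => K * Real.sqrt δ * ∫ u, heatPhi u * |u| := by fun_prop
    simpa using (h.tendsto 0).mono_left (nhdsWithin_le_nhds (s := Set.Ioi 0))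
  refine squeeze_zero' (Eventually.of_forall fun δ => dist_nonneg) ?_ hzero
  filter_upwards [self_mem_nhdsWithin] with δ hδ
  have hp := pc_heatConv hδ hρ
  have hint : ∀ {σ : ℝ → ℝ}, Pc σ → Integrable fun x => Wconv W σ x * heatConv ρ δ x :=
    fun hσ => hp.2.1.bdd_mul (continuous_Wconv hW hC hσ.2.1).aestronglyMeasurable
      (Eventually.of_forall (abs_Wconv_le hC hσ))
  rw [dist_comm, Real.dist_eq, ← integral_sub (hint hp) (hint hρ)]
  have hpt : ∀ x, |Wconv W (heatConv ρ δ) x - Wconv W ρ x|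
      ≤ K * Real.sqrt δ * ∫ u, heatPhi u * |u| := fun x =>
    abs_integral_mul_heatConv_sub_le (g := fun w => W (x - w)) hδ hρ
      (LipschitzWith.of_dist_le_mul fun a b => by
        simpa only [dist_sub_left] using hK.dist_le_mul (x - a) (x - b)) fun w => hC _
  have h := norm_integral_le_of_norm_le
    (f := fun x => Wconv W (heatConv ρ δ) x * heatConv ρ δ x - Wconv W ρ x * heatConv ρ δ x)
    (hp.2.1.const_mul (K * Real.sqrt δ * ∫ u, heatPhi u * |u|))
    (Eventually.of_forall fun x => by
      rw [← sub_mul, norm_mul, Real.norm_of_nonneg (hp.1 x)]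
      exact mul_le_mul_of_nonneg_right (hpt x) (hp.1 x))
  rwa [integral_const_mul, hp.2.2, mul_one] at h

/-- Γ-convergence of the regularised energies: limsup inequality. For any `ρ ∈ P_c(ℝ)`
there is a recovery family `ρ_δ ∈ P_c(ℝ)` converging weakly to `ρ` with
`limsup_{δ→0} E_δ(ρ_δ) ≤ E(ρ)`; one may take `ρ_δ = φ_δ ∗ ρ`, the mollification
by the heat kernel. -/
theorem gamma_limsup
    (W : ℝ → ℝ)
    (hW0 : ∀ x, W (-x) = W x)
    (hW1 : ContDiff ℝ 1 W)
    (hW3 : ∀ x : ℝ, 1 / 2 ≤ |x| → deriv W x = 0)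
    (ρ : ℝ → ℝ) (hρ : Pc ρ) :
    ∃ ρδ : ℝ → ℝ → ℝ,
      (∀ δ : ℝ, 0 < δ → ρδ δ = fun x => ∫ w, heatPhiδ δ (x - w) * ρ w) ∧
      (∀ δ : ℝ, 0 < δ → Pc (ρδ δ)) ∧
      (∀ g : BoundedContinuousFunction ℝ ℝ,
        Tendsto (fun δ : ℝ => ∫ x, g x * ρδ δ x) (𝓝[>] (0 : ℝ))
          (𝓝 (∫ x, g x * ρ x))) ∧
      Filter.limsup (fun δ : ℝ => Ereg W δ (ρδ δ)) (𝓝[>] (0 : ℝ)) ≤ Ereg W 0 ρ := by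
  obtain ⟨C, hC⟩ := exists_abs_le_of_deriv_eq_zero hW0 hW1 hW3
  obtain ⟨K, hK⟩ := exists_lipschitzWith_of_deriv_eq_zero hW1 hW3
  refine ⟨heatConv ρ, fun δ _ => rfl, fun δ hδ => pc_heatConv hδ hρ,
    fun g => tendsto_integral_mul_heatConv hρ.2.1 g.continuous g.norm_coe_le_norm, ?_⟩
  have hlim := ((tendsto_integral_Wconv_heatConv hK hC hρ).add
    (tendsto_mul_integral_heatConv_sq hρ)).const_mul (1 / 2)
  have hE : Tendsto (fun δ => Ereg W δ (heatConv ρ δ)) (𝓝[>] (0 : ℝ)) (𝓝 (Ereg W 0 ρ)) := by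
    have h0 : Ereg W 0 ρ = 1 / 2 * ((∫ x, Wconv W ρ x * ρ x) + 0) := by
      simp only [Ereg, zero_mul, add_zero, mul_comm (ρ _)]
    rw [h0]
    refine hlim.congr' ?_
    filter_upwards [self_mem_nhdsWithin] with δ hδ
    exact (Ereg_eq_add hK.continuous hC (pc_heatConv hδ hρ) (integrable_heatConv_sq hδ hρ) δ).symm
  exact hE.limsup_eq.le
end

section
/- (Concentration-compactness for probability measures on ℝ.) Let {ρ_n}_{n∈ℕ} be a sequence of probability measures on ℝ. Then there exists a subsequence {ρ_{n_k}} satisfying exactly one of the following three possibilities: (i) tightness up to translation: there exist points z_k ∈ ℝ such that for all ε > 0 there exists R > 0 with ρ_{n_k}(B_R(z_k)) ≥ 1 − ε for all k; (ii) vanishing: for all R > 0, lim_{k→∞} sup_{z∈ℝ} ρ_{n_k}(B_R(z)) = 0; (iii) dichotomy: there exists α ∈ (0,1) such that for all ε > 0 there exist R > 0 and a sequence {z_k} ⊂ ℝ with the property that for any R′ > R there are nonnegative measures ρ_k¹, ρ_k² with 0 ≤ ρ_k¹ + ρ_k² ≤ ρ_{n_k}, supp(ρ_k¹) ⊂ B_R(z_k),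 supp(ρ_k²) ⊂ ℝ ∖ B_{R′}(z_k), and limsup_{k→∞} (|α − ρ_k¹(ℝ)| + |(1−α) − ρ_k²(ℝ)|) ≤ ε. -/
open MeasureTheory Filter Topology

/-- Tightness up to translation of a sequence of probability measures on `ℝ`. -/
def TightUpToTranslation (ν : ℕ → Measure ℝ) : Prop :=
  ∃ z : ℕ → ℝ, ∀ ε : ℝ, 0 < ε → ∃ R : ℝ, 0 < R ∧
    ∀ k, 1 - ε ≤ (ν k (Metric.ball (z k) R)).toReal

/-- Vanishing of a sequence of probability measures on `ℝ`. -/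
def Vanishing (ν : ℕ → Measure ℝ) : Prop :=
  ∀ R : ℝ, 0 < R →
    Tendsto (fun k => ⨆ z : ℝ, (ν k (Metric.ball z R)).toReal) atTop (𝓝 0)

/-- Dichotomy of a sequence of probability measures on `ℝ`. -/
def Dichotomy (ν : ℕ → Measure ℝ) : Prop :=
  ∃ α : ℝ, α ∈ Set.Ioo (0 : ℝ) 1 ∧
    ∀ ε : ℝ, 0 < ε → ∃ R : ℝ, 0 < R ∧ ∃ z : ℕ → ℝ,
      ∀ R' : ℝ, R < R' → ∃ ρ1 ρ2 : ℕ → Measure ℝ,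
        (∀ k, ρ1 k + ρ2 k ≤ ν k) ∧
        (∀ k, ρ1 k ((Metric.ball (z k) R)ᶜ) = 0) ∧
        (∀ k, ρ2 k (Metric.ball (z k) R') = 0) ∧
        Filter.limsup
          (fun k => |α - (ρ1 k Set.univ).toReal| + |(1 - α) - (ρ2 k Set.univ).toReal|)
          atTop ≤ ε

/-- The Lévy concentration function of a measure on `ℝ`. -/
noncomputable def concentration (μ : Measure ℝ) (R : ℝ) : ℝ :=
  ⨆ z : ℝ, μ.real (Metric.ball z R)

section Concentration

variable (μ : Measure ℝ)

lemma concentration_nonneg (R : ℝ) : 0 ≤ concentration μ R :=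
  Real.iSup_nonneg fun _ => measureReal_nonneg

lemma exists_lt_measureReal_ball {R a : ℝ} (h : a < concentration μ R) :
    ∃ z : ℝ, a < μ.real (Metric.ball z R) :=
  exists_lt_of_lt_ciSup h

variable [IsProbabilityMeasure μ]

lemma bddAbove_range_measureReal_ball (R : ℝ) :
    BddAbove (Set.range fun z : ℝ => μ.real (Metric.ball z R)) :=
  ⟨1, by rintro _ ⟨z, rfl⟩; exact measureReal_le_one⟩

lemma measureReal_ball_le_concentration (z R : ℝ) :
    μ.real (Metric.ball z R) ≤ concentration μ R :=
  le_ciSup (bddAbove_range_measureReal_ball μ R) z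

lemma concentration_le_one (R : ℝ) : concentration μ R ≤ 1 :=
  ciSup_le fun _ => measureReal_le_one

lemma concentration_mono : Monotone (concentration μ) := fun _ S h =>
  ciSup_mono (bddAbove_range_measureReal_ball μ S) fun _ =>
    measureReal_mono (Metric.ball_subset_ball h)

/-- Two balls of total mass larger than `1` meet, so an enlargement of one contains the other. -/
lemma ball_subset_ball_of_one_lt_add {x y r s : ℝ}
    (h : 1 < μ.real (Metric.ball x r) + μ.real (Metric.ball y s)) :
    Metric.ball y s ⊆ Metric.ball x (r + 2 * s) := by
  have hmeet : ¬ Disjoint (Metric.ball x r) (Metric.ball y s) := by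
    intro hd
    have hunion := measureReal_union (μ := μ) hd Metric.isOpen_ball.measurableSet
    have hle : μ.real (Metric.ball x r ∪ Metric.ball y s) ≤ 1 := measureReal_le_one
    linarith
  obtain ⟨w, hwx, hwy⟩ := Set.not_disjoint_iff.mp hmeet
  intro v hv
  rw [Metric.mem_ball] at *
  have h₁ := dist_triangle v y x
  have h₂ := dist_triangle_left y x w
  linarith

lemma exists_radius_measureReal_ball (z : ℝ) {ε : ℝ} (hε : 0 < ε) :
    ∃ R : ℝ, 1 - ε ≤ μ.real (Metric.ball z R) := by
  have hmono : Monotone fun n : ℕ => Metric.ball z (n : ℝ) := fun _ _ h =>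
    Metric.ball_subset_ball (by exact_mod_cast h)
  have hlim := tendsto_measure_iUnion_atTop (μ := μ) hmono
  rw [Metric.iUnion_ball_nat, measure_univ] at hlim
  have hreal := (ENNReal.tendsto_toReal ENNReal.one_ne_top).comp hlim
  have hev := hreal.eventually_const_lt
    (show 1 - ε < ENNReal.toReal 1 by rw [ENNReal.toReal_one]; linarith)
  obtain ⟨n, hn⟩ := hev.exists
  exact ⟨n, hn.le⟩

end Concentration

section Exclusion

variable {ν : ℕ → Measure ℝ} [∀ k, IsProbabilityMeasure (ν k)]

lemma Dichotomy.exists_eventually_mass (h : Dichotomy ν) :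
    ∃ α ∈ Set.Ioo (0 : ℝ) 1, ∀ ε : ℝ, 0 < ε → ∃ R : ℝ, 0 < R ∧ ∃ z : ℕ → ℝ,
      ∀ R' : ℝ, R < R' → ∀ᶠ k in atTop,
        α - ε ≤ (ν k).real (Metric.ball (z k) R) ∧
        (ν k).real (Metric.ball (z k) R') ≤ α + ε := by
  obtain ⟨α, hα, h⟩ := h
  refine ⟨α, hα, fun ε hε => ?_⟩
  obtain ⟨R, hR, z, h⟩ := h (ε / 2) (half_pos hε)
  refine ⟨R, hR, z, fun R' hR' => ?_⟩
  obtain ⟨ρ1, ρ2, hle, h1, h2, hlim⟩ := h R' hR'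
  have le1 (k : ℕ) : ρ1 k ≤ ν k := (Measure.le_add_right le_rfl).trans (hle k)
  have le2 (k : ℕ) : ρ2 k ≤ ν k := (Measure.le_add_left le_rfl).trans (hle k)
  have mass1 (k : ℕ) : (ρ1 k).real Set.univ ≤ (ν k).real (Metric.ball (z k) R) := by
    refine ENNReal.toReal_mono (measure_ne_top _ _) ?_
    rw [← measure_add_measure_compl (μ := ρ1 k) (Metric.isOpen_ball (x := z k)
      (ε := R)).measurableSet, h1, add_zero]
    exact le1 k _
  have mass2 (k : ℕ) : (ρ2 k).real Set.univ ≤ 1 - (ν k).real (Metric.ball (z k) R') := by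
    rw [← probReal_compl_eq_one_sub Metric.isOpen_ball.measurableSet]
    refine ENNReal.toReal_mono (measure_ne_top _ _) ?_
    rw [← measure_add_measure_compl (μ := ρ2 k) (Metric.isOpen_ball (x := z k)
      (ε := R')).measurableSet, h2, zero_add]
    exact le2 k _
  have hbdd : IsBoundedUnder (· ≤ ·) atTop fun k =>
      |α - (ρ1 k Set.univ).toReal| + |(1 - α) - (ρ2 k Set.univ).toReal| := by
    refine isBoundedUnder_of ⟨2, fun k => ?_⟩
    have u1 : (ρ1 k).real Set.univ ≤ 1 := (mass1 k).trans measureReal_le_one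
    have u2 : (ρ2 k).real Set.univ ≤ 1 :=
      (mass2 k).trans (sub_le_self _ measureReal_nonneg)
    have n1 : 0 ≤ (ρ1 k).real Set.univ := measureReal_nonneg
    have n2 : 0 ≤ (ρ2 k).real Set.univ := measureReal_nonneg
    simp only [Measure.real] at u1 u2 n1 n2
    have a1 : |α - (ρ1 k Set.univ).toReal| ≤ 1 :=
      abs_le.mpr ⟨by linarith [hα.1], by linarith [hα.2]⟩
    have a2 : |(1 - α) - (ρ2 k Set.univ).toReal| ≤ 1 :=
      abs_le.mpr ⟨by linarith [hα.2], by linarith [hα.1]⟩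
    linarith
  filter_upwards [eventually_lt_of_limsup_lt (hlim.trans_lt (half_lt_self hε)) hbdd] with k hk
  have m1 := mass1 k
  have m2 := mass2 k
  rw [Measure.real] at m1 m2
  have a1 := le_abs_self (α - (ρ1 k Set.univ).toReal)
  have a2 := le_abs_self ((1 - α) - (ρ2 k Set.univ).toReal)
  have b1 := abs_nonneg (α - (ρ1 k Set.univ).toReal)
  have b2 := abs_nonneg ((1 - α) - (ρ2 k Set.univ).toReal)
  constructor <;> linarith

lemma TightUpToTranslation.not_vanishing (ht : TightUpToTranslation ν) : ¬ Vanishing ν := by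
  intro hv
  obtain ⟨z, hz⟩ := ht
  obtain ⟨R, hR, hz⟩ := hz (1 / 2) (by norm_num)
  obtain ⟨k, hk⟩ := ((hv R hR).eventually_lt_const (show (0 : ℝ) < 1 / 2 by norm_num)).exists
  have h₁ := measureReal_ball_le_concentration (ν k) (z k) R
  have h₂ := hz k
  simp only [concentration, Measure.real] at h₁
  linarith

lemma Dichotomy.not_vanishing (hd : Dichotomy ν) : ¬ Vanishing ν := by
  intro hv
  obtain ⟨α, hα, h⟩ := hd.exists_eventually_mass
  obtain ⟨R, hR, z, h⟩ := h (α / 2) (half_pos hα.1)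
  obtain ⟨k, hk, hk'⟩ := (((hv R hR).eventually_lt_const (half_pos hα.1)).and
    (h (R + 1) (lt_add_one R))).exists
  have h₁ := measureReal_ball_le_concentration (ν k) (z k) R
  have h₂ := hk'.1
  simp only [concentration, Measure.real] at h₁ h₂
  linarith

lemma Dichotomy.not_tightUpToTranslation (hd : Dichotomy ν) : ¬ TightUpToTranslation ν := by
  rintro ⟨w, hw⟩
  obtain ⟨α, hα, h⟩ := hd.exists_eventually_mass
  obtain ⟨ε, hε, hlt⟩ := exists_between
    (lt_min (half_pos hα.1) (half_pos (sub_pos.mpr hα.2)))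
  obtain ⟨hε₁, hε₂⟩ := lt_min_iff.mp hlt
  obtain ⟨R, -, z, h⟩ := h ε hε
  obtain ⟨S, hS, hw⟩ := hw ε hε
  obtain ⟨k, hk₁, hk₂⟩ := (h (R + 2 * S) (by linarith)).exists
  have hwk : 1 - ε ≤ (ν k).real (Metric.ball (w k) S) := hw k
  have hsub := ball_subset_ball_of_one_lt_add (ν k) (x := z k) (r := R) (y := w k) (s := S)
    (by linarith)
  have hmass := measureReal_mono (μ := ν k) hsub
  linarith

end Exclusion

section Trichotomy

variable {ν : ℕ → Measure ℝ} [∀ k, IsProbabilityMeasure (ν k)] {q : ℕ → ℝ}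

lemma vanishing_of_tendsto_concentration
    (hq : ∀ m : ℕ, Tendsto (fun k => concentration (ν k) m) atTop (𝓝 (q m)))
    (h0 : ∀ m, q m ≤ 0) : Vanishing ν := by
  intro R _
  obtain ⟨m, hm⟩ := exists_nat_ge R
  have hm0 : q m = 0 :=
    (h0 m).antisymm (ge_of_tendsto' (hq m) fun k => concentration_nonneg (ν k) m)
  exact squeeze_zero (fun k => concentration_nonneg (ν k) R)
    (fun k => concentration_mono (ν k) hm) (hm0 ▸ hq m)

lemma tightUpToTranslation_of_tendsto_concentration
    (hq : ∀ m : ℕ, Tendsto (fun k => concentration (ν k) m) atTop (𝓝 (q m)))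
    (h1 : ∀ a < 1, ∃ m, a < q m) : TightUpToTranslation ν := by
  obtain ⟨m₀, hm₀⟩ := h1 (1 / 2) (by norm_num)
  have hcentre (k : ℕ) : ∃ z, 1 / 2 < concentration (ν k) m₀ →
      1 / 2 < (ν k).real (Metric.ball z m₀) := by
    by_cases h : 1 / 2 < concentration (ν k) m₀
    · obtain ⟨z, hz⟩ := exists_lt_measureReal_ball (ν k) h
      exact ⟨z, fun _ => hz⟩
    · exact ⟨0, fun h' => absurd h' h⟩
  choose z hz using hcentre
  refine ⟨z, fun ε hε => ?_⟩
  obtain ⟨m, hm⟩ := h1 (1 - min ε (1 / 2)) (by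
    have := lt_min hε (show (0 : ℝ) < 1 / 2 by norm_num)
    linarith)
  obtain ⟨K, hK⟩ := eventually_atTop.mp
    (((hq m₀).eventually_const_lt hm₀).and ((hq m).eventually_const_lt hm))
  choose r hr using fun k => exists_radius_measureReal_ball (ν k) (z k) hε
  obtain ⟨B, hB⟩ := ((Set.finite_Iio K).image r).bddAbove
  refine ⟨max (max B (m₀ + 2 * m)) 1, lt_max_of_lt_right one_pos, fun k => ?_⟩
  change 1 - ε ≤ (ν k).real _
  rcases lt_or_ge k K with hk | hk
  · exact (hr k).trans (measureReal_mono (Metric.ball_subset_ball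
      ((hB ⟨k, hk, rfl⟩).trans ((le_max_left _ _).trans (le_max_left _ _)))))
  · obtain ⟨hk₀, hk₁⟩ := hK k hk
    obtain ⟨w, hw⟩ := exists_lt_measureReal_ball (ν k) hk₁
    have hzk := hz k hk₀
    have hε₁ := min_le_left ε (1 / 2)
    have hε₂ := min_le_right ε (1 / 2)
    have hsub := ball_subset_ball_of_one_lt_add (ν k) (x := z k) (r := m₀) (y := w) (s := m)
      (by linarith)
    have hmass := measureReal_mono (μ := ν k) (hsub.trans (Metric.ball_subset_ball
      ((le_max_right B _).trans (le_max_left _ (1 : ℝ)))))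
    linarith

lemma dichotomy_of_tendsto_concentration
    (hq : ∀ m : ℕ, Tendsto (fun k => concentration (ν k) m) atTop (𝓝 (q m)))
    {α : ℝ} (hα : α ∈ Set.Ioo (0 : ℝ) 1) (hle : ∀ m, q m ≤ α) (hlt : ∀ a < α, ∃ m, a < q m) :
    Dichotomy ν := by
  refine ⟨α, hα, fun ε hε => ?_⟩
  obtain ⟨m, hm⟩ := hlt (α - ε / 4) (by linarith)
  have hqm : Monotone q := fun i j hij => le_of_tendsto_of_tendsto' (hq i) (hq j) fun k =>
    concentration_mono (ν k) (by exact_mod_cast hij)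
  replace hm : α - ε / 4 < q (m + 1) := hm.trans_le (hqm m.le_succ)
  choose z hz using fun k => exists_lt_measureReal_ball (ν k)
    (show concentration (ν k) ((m + 1 : ℕ) : ℝ) - ε / 4 < concentration (ν k) (m + 1 : ℕ) by
      linarith)
  refine ⟨(m + 1 : ℕ), by positivity, z, fun R' hR' => ?_⟩
  refine ⟨fun k => (ν k).restrict (Metric.ball (z k) (m + 1 : ℕ)),
    fun k => (ν k).restrict (Metric.ball (z k) R')ᶜ, fun k => ?_, fun k => ?_, fun k => ?_, ?_⟩
  · have hd : Disjoint (Metric.ball (z k) (m + 1 : ℕ)) (Metric.ball (z k) R')ᶜ :=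
      Set.disjoint_compl_right_iff_subset.mpr (Metric.ball_subset_ball hR'.le)
    rw [← Measure.restrict_union hd Metric.isOpen_ball.measurableSet.compl]
    exact Measure.restrict_le_self
  · rw [Measure.restrict_apply Metric.isOpen_ball.measurableSet.compl, Set.compl_inter_self,
      measure_empty]
  · rw [Measure.restrict_apply Metric.isOpen_ball.measurableSet, Set.inter_compl_self,
      measure_empty]
  · obtain ⟨M, hM⟩ := exists_nat_ge R'
    refine limsup_le_of_le (isBoundedUnder_of ⟨0, fun k => ?_⟩).isCoboundedUnder_le ?_
    · exact add_nonneg (abs_nonneg _) (abs_nonneg _)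
    filter_upwards [(hq (m + 1)).eventually_const_lt hm,
      (hq M).eventually_lt_const ((hle M).trans_lt (show α < α + ε / 4 by linarith))]
      with k hk₁ hk₂
    have hcompl := probReal_compl_eq_one_sub (μ := ν k)
      (Metric.isOpen_ball (x := z k) (ε := R')).measurableSet
    have hmono : (ν k).real (Metric.ball (z k) (m + 1 : ℕ)) ≤
        (ν k).real (Metric.ball (z k) R') := measureReal_mono (Metric.ball_subset_ball hR'.le)
    have hup := (measureReal_ball_le_concentration (ν k) (z k) R').trans
      (concentration_mono (ν k) hM)
    have hzk := hz k
    rw [Measure.restrict_apply_univ, Measure.restrict_apply_univ]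
    change |α - (ν k).real _| + |1 - α - (ν k).real _| ≤ ε
    rw [hcompl]
    have a1 : |α - (ν k).real (Metric.ball (z k) (m + 1 : ℕ))| ≤ ε / 2 :=
      abs_le.mpr ⟨by linarith, by linarith⟩
    have a2 : |1 - α - (1 - (ν k).real (Metric.ball (z k) R'))| ≤ ε / 2 :=
      abs_le.mpr ⟨by linarith, by linarith⟩
    linarith

end Trichotomy

lemma exists_subseq_tendsto_concentration (μ : ℕ → Measure ℝ)
    [∀ n, IsProbabilityMeasure (μ n)] :
    ∃ (φ : ℕ → ℕ) (q : ℕ → ℝ), StrictMono φ ∧ (∀ m, q m ≤ 1) ∧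
      ∀ m : ℕ, Tendsto (fun k => concentration (μ (φ k)) m) atTop (𝓝 (q m)) := by
  have hcompact : IsCompact (Set.univ.pi fun _ : ℕ => Set.Icc (0 : ℝ) 1) :=
    isCompact_univ_pi fun _ => isCompact_Icc
  obtain ⟨q, hq, φ, hφ, hlim⟩ := hcompact.tendsto_subseq
    (x := fun n (m : ℕ) => concentration (μ n) m)
    fun n m _ => ⟨concentration_nonneg (μ n) m, concentration_le_one (μ n) m⟩
  exact ⟨φ, q, hφ, fun m => (hq m trivial).2, fun m => tendsto_pi_nhds.mp hlim m⟩

/-- Concentration-compactness lemma for probability measures on `ℝ`: every sequence has a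
subsequence satisfying exactly one of: tightness up to translation, vanishing, or
dichotomy. -/
theorem concentration_compactness
    (μ : ℕ → Measure ℝ) (hμ : ∀ n, IsProbabilityMeasure (μ n)) :
    ∃ φ : ℕ → ℕ, StrictMono φ ∧
      ((TightUpToTranslation (μ ∘ φ) ∧ ¬ Vanishing (μ ∘ φ) ∧ ¬ Dichotomy (μ ∘ φ)) ∨
       (¬ TightUpToTranslation (μ ∘ φ) ∧ Vanishing (μ ∘ φ) ∧ ¬ Dichotomy (μ ∘ φ)) ∨
       (¬ TightUpToTranslation (μ ∘ φ) ∧ ¬ Vanishing (μ ∘ φ) ∧ Dichotomy (μ ∘ φ))) := by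
  obtain ⟨φ, q, hφ, hq1, hq⟩ := exists_subseq_tendsto_concentration μ
  refine ⟨φ, hφ, ?_⟩
  have : ∀ k, IsProbabilityMeasure ((μ ∘ φ) k) := fun k => hμ (φ k)
  replace hq : ∀ m : ℕ, Tendsto (fun k => concentration ((μ ∘ φ) k) m) atTop (𝓝 (q m)) := hq
  have hbdd : BddAbove (Set.range q) := ⟨1, by rintro _ ⟨m, rfl⟩; exact hq1 m⟩
  have hle (m : ℕ) : q m ≤ iSup q := le_ciSup hbdd m
  have hlt (a : ℝ) (ha : a < iSup q) : ∃ m, a < q m := exists_lt_of_lt_ciSup ha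
  rcases le_or_gt (iSup q) 0 with h0 | h0
  · have hv := vanishing_of_tendsto_concentration hq fun m => (hle m).trans h0
    exact .inr (.inl ⟨fun ht => ht.not_vanishing hv, hv, fun hd => hd.not_vanishing hv⟩)
  rcases lt_or_ge (iSup q) 1 with h1 | h1
  · have hd := dichotomy_of_tendsto_concentration hq ⟨h0, h1⟩ hle hlt
    exact .inr (.inr ⟨hd.not_tightUpToTranslation, hd.not_vanishing, hd⟩)
  · have ht := tightUpToTranslation_of_tendsto_concentration hq
      fun a ha => hlt a (ha.trans_le h1)
    exact .inl ⟨ht, ht.not_vanishing, fun hd => hd.not_tightUpToTranslation ht⟩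
end

section
/- (Positivity and stability of the scheme under a CFL condition.) Let ρ⁰ : ℤ² → ℝ be nonnegative and summable with ∑_{i,j} ρ⁰_{ij} Δx Δy = 1, and let {ρⁿ} be generated by the finite-volume update with δ > 0. Suppose each time step satisfies the CFL condition (2f(1/Δx + 1/Δy) + δ rₙ (1/(Δx)² + 1/(Δy)²)) Δtⁿ ≤ 1, where rₙ = sup_{i,j} ρⁿ_{ij}. Then for all i, j and n: ρⁿ_{ij} ≥ 0, |(u_x)ⁿ_{ij}| ≤ f and |(u_y)ⁿ_{ij}| ≤ f; moreover there is a constant r > 0 (one may take r = 1/(ΔxΔy)) with sup_{n,i,j} ρⁿ_{ij} ≤ r. -/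
open MeasureTheory Filter Topology

/-- The discrete velocity `u_{ij} = (Δx Δy)⁻¹ ∑_{k,l} ρ_{kl} K_{ij}^{kl}`. -/
noncomputable def vel (Δx Δy : ℝ) (K : ℤ × ℤ → ℤ × ℤ → ℝ) (ρ : ℤ × ℤ → ℝ)
    (i j : ℤ) : ℝ :=
  (Δx * Δy)⁻¹ * ∑' p : ℤ × ℤ, ρ p * K (i, j) p

/-- The finite-volume update of the scheme for the anisotropic aggregation equation with
nonlinear diffusion: transport with midpoint velocities/densities, the numerical
viscosity terms with constant `f`, and the discretised nonlinear diffusion with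
coefficient `δ`. -/
def FVUpdate (Δx Δy f δ : ℝ) (Δt : ℕ → ℝ) (Fx Fy : ℤ × ℤ → ℤ × ℤ → ℝ)
    (ρ : ℕ → ℤ × ℤ → ℝ) : Prop :=
  ∀ n : ℕ, ∀ i j : ℤ,
    ρ (n + 1) (i, j) =
      ρ n (i, j)
      - (Δt n / Δx) *
          ((vel Δx Δy Fx (ρ n) i j + vel Δx Δy Fx (ρ n) (i + 1) j) / 2 *
              ((ρ n (i, j) + ρ n (i + 1, j)) / 2)
            - (vel Δx Δy Fx (ρ n) (i - 1) j + vel Δx Δy Fx (ρ n) i j) / 2 *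
              ((ρ n (i - 1, j) + ρ n (i, j)) / 2))
      - (Δt n / Δy) *
          ((vel Δx Δy Fy (ρ n) i j + vel Δx Δy Fy (ρ n) i (j + 1)) / 2 *
              ((ρ n (i, j) + ρ n (i, j + 1)) / 2)
            - (vel Δx Δy Fy (ρ n) i (j - 1) + vel Δx Δy Fy (ρ n) i j) / 2 *
              ((ρ n (i, j - 1) + ρ n (i, j)) / 2))
      + (Δt n * f / (2 * Δx)) * (ρ n (i + 1, j) - 2 * ρ n (i, j) + ρ n (i - 1, j))
      + (Δt n * f / (2 * Δy)) * (ρ n (i, j + 1) - 2 * ρ n (i, j) + ρ n (i, j - 1))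
      + (δ * Δt n / (2 * Δx ^ 2)) *
          ((ρ n (i + 1, j)) ^ 2 - 2 * (ρ n (i, j)) ^ 2 + (ρ n (i - 1, j)) ^ 2)
      + (δ * Δt n / (2 * Δy ^ 2)) *
          ((ρ n (i, j + 1)) ^ 2 - 2 * (ρ n (i, j)) ^ 2 + (ρ n (i, j - 1)) ^ 2)

theorem abs_midpoint_le {a b f : ℝ} (ha : |a| ≤ f) (hb : |b| ≤ f) : |(a + b) / 2| ≤ f := by
  have h₁ := abs_le.1 ha
  have h₂ := abs_le.1 hb
  exact abs_le.2 ⟨by linarith, by linarith⟩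

theorem abs_vel_le {Δx Δy f : ℝ} (hΔx : 0 < Δx) (hΔy : 0 < Δy)
    {K : ℤ × ℤ → ℤ × ℤ → ℝ} (hK : ∀ p q, |K p q| ≤ f * (Δx * Δy) ^ 2)
    {ρ : ℤ × ℤ → ℝ} (hρ : ∀ p, 0 ≤ ρ p) (hmass : HasSum ρ (Δx * Δy)⁻¹) (i j : ℤ) :
    |vel Δx Δy K ρ i j| ≤ f := by
  have hpos : 0 < Δx * Δy := mul_pos hΔx hΔy
  have hsum : |∑' p : ℤ × ℤ, ρ p * K (i, j) p| ≤ (Δx * Δy)⁻¹ * (f * (Δx * Δy) ^ 2) := by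
    rw [← Real.norm_eq_abs]
    refine tsum_of_norm_bounded (hmass.mul_right _) fun p => ?_
    rw [Real.norm_eq_abs, abs_mul, abs_of_nonneg (hρ p)]
    exact mul_le_mul_of_nonneg_left (hK _ _) (hρ p)
  calc |vel Δx Δy K ρ i j|
      = (Δx * Δy)⁻¹ * |∑' p : ℤ × ℤ, ρ p * K (i, j) p| := by
        rw [vel, abs_mul, abs_of_pos (inv_pos.2 hpos)]
    _ ≤ (Δx * Δy)⁻¹ * ((Δx * Δy)⁻¹ * (f * (Δx * Δy) ^ 2)) := by gcongr
    _ = f := by field_simp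

theorem Summable.hasSum_sub_comp_equiv {α : Type*} {G : α → ℝ} (hG : Summable G) (e : α ≃ α) :
    HasSum (fun p => G p - G (e p)) 0 := by
  simpa using hG.hasSum.sub (e.hasSum_iff.2 hG.hasSum)

theorem Summable.bounded_mul {α : Type*} {u v : α → ℝ} {f : ℝ} (hv : Summable v)
    (hu : ∀ p, |u p| ≤ f) : Summable fun p => u p * v p := by
  refine Summable.of_norm_bounded (hv.abs.mul_left f) fun p => ?_
  rw [Real.norm_eq_abs, abs_mul]
  exact mul_le_mul_of_nonneg_right (hu p) (abs_nonneg _)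

/-- The numerical flux through the interface between `p` and its neighbour `e p`, for a transport
coefficient `A`, a viscosity `a` and a nonlinear diffusion coefficient `c`. -/
noncomputable def interfaceFlux (A a c : ℝ) (u ρ : ℤ × ℤ → ℝ) (e : ℤ × ℤ ≃ ℤ × ℤ)
    (p : ℤ × ℤ) : ℝ :=
  A * ((u p + u (e p)) / 2 * ((ρ p + ρ (e p)) / 2)) - a * (ρ (e p) - ρ p)
    - c * (ρ (e p) ^ 2 - ρ p ^ 2)

theorem summable_interfaceFlux (A a c : ℝ) {f M : ℝ} {u ρ : ℤ × ℤ → ℝ} (e : ℤ × ℤ ≃ ℤ × ℤ)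
    (hρ : Summable ρ) (hM : ∀ p, |ρ p| ≤ M) (hu : ∀ p, |u p| ≤ f) :
    Summable (interfaceFlux A a c u ρ e) := by
  have hρe : Summable fun p => ρ (e p) := e.summable_iff.2 hρ
  have hsq : Summable fun p => ρ p ^ 2 := by
    simpa only [sq] using hρ.bounded_mul hM
  have hsqe : Summable fun p => ρ (e p) ^ 2 := e.summable_iff (f := fun p => ρ p ^ 2) |>.2 hsq
  exact (((((hρ.add hρe).div_const 2).bounded_mul
    fun p => abs_midpoint_le (hu p) (hu (e p))).mul_left A).sub
    ((hρe.sub hρ).mul_left a)).sub ((hsqe.sub hsq).mul_left c)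

theorem directional_update_lower_bound {A C f r rE rW uE uW : ℝ} (hA : 0 ≤ A) (hC : 0 ≤ C)
    (hr : 0 ≤ r) (hrE : 0 ≤ rE) (hrW : 0 ≤ rW) (huE : |uE| ≤ f) (huW : |uW| ≤ f) :
    -((2 * f * A + C * r) * r) ≤
      -(A * (uE * ((r + rE) / 2) - uW * ((rW + r) / 2))) + A * f / 2 * (rE - 2 * r + rW)
        + C / 2 * (rE ^ 2 - 2 * r ^ 2 + rW ^ 2) := by
  obtain ⟨hE₁, hE₂⟩ := abs_le.1 huE
  obtain ⟨hW₁, hW₂⟩ := abs_le.1 huW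
  have h₁ : 0 ≤ A * rE * (f - uE) := by apply mul_nonneg (by positivity); linarith
  have h₂ : 0 ≤ A * rW * (f + uW) := by apply mul_nonneg (by positivity); linarith
  have h₃ : 0 ≤ A * r * (2 * f - uE + uW) := by apply mul_nonneg (by positivity); linarith
  have h₄ : 0 ≤ C * (rE ^ 2 + rW ^ 2) := by positivity
  linarith

/-- Mass conservation for one step of the scheme. -/
theorem FVUpdate.hasSum_succ {Δx Δy f δ : ℝ} {Δt : ℕ → ℝ} {Fx Fy : ℤ × ℤ → ℤ × ℤ → ℝ}
    {ρ : ℕ → ℤ × ℤ → ℝ} (hupd : FVUpdate Δx Δy f δ Δt Fx Fy ρ) {n : ℕ} {m M : ℝ}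
    (hmass : HasSum (ρ n) m) (hM : ∀ p, |ρ n p| ≤ M)
    (hux : ∀ i j, |vel Δx Δy Fx (ρ n) i j| ≤ f) (huy : ∀ i j, |vel Δx Δy Fy (ρ n) i j| ≤ f) :
    HasSum (ρ (n + 1)) m := by
  let ex : ℤ × ℤ ≃ ℤ × ℤ := (Equiv.addRight (1 : ℤ)).prodCongr (Equiv.refl ℤ)
  let ey : ℤ × ℤ ≃ ℤ × ℤ := (Equiv.refl ℤ).prodCongr (Equiv.addRight (1 : ℤ))
  let G := interfaceFlux (Δt n / Δx) (Δt n * f / (2 * Δx)) (δ * Δt n / (2 * Δx ^ 2))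
    (fun p => vel Δx Δy Fx (ρ n) p.1 p.2) (ρ n) ex
  let H := interfaceFlux (Δt n / Δy) (Δt n * f / (2 * Δy)) (δ * Δt n / (2 * Δy ^ 2))
    (fun p => vel Δx Δy Fy (ρ n) p.1 p.2) (ρ n) ey
  have hG : Summable G := summable_interfaceFlux _ _ _ ex hmass.summable hM fun p => hux p.1 p.2
  have hH : Summable H := summable_interfaceFlux _ _ _ ey hmass.summable hM fun p => huy p.1 p.2
  have key := (hmass.sub (hG.hasSum_sub_comp_equiv ex.symm)).sub
    (hH.hasSum_sub_comp_equiv ey.symm)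
  rw [sub_zero, sub_zero] at key
  suffices h : ρ (n + 1) = _ from h ▸ key
  funext ⟨i, j⟩
  rw [hupd n i j]
  simp only [G, H, interfaceFlux, Equiv.apply_symm_apply]
  simp only [ex, ey, Equiv.prodCongr_symm, Equiv.prodCongr_apply, Prod.map_apply,
    Equiv.refl_symm, Equiv.refl_apply, Equiv.coe_addRight, Equiv.addRight_symm, ← sub_eq_add_neg]
  ring

/-- Positivity for one step of the scheme. -/
theorem FVUpdate.nonneg_succ {Δx Δy f δ : ℝ} {Δt : ℕ → ℝ} {Fx Fy : ℤ × ℤ → ℤ × ℤ → ℝ}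
    {ρ : ℕ → ℤ × ℤ → ℝ} (hupd : FVUpdate Δx Δy f δ Δt Fx Fy ρ) (hΔx : 0 < Δx) (hΔy : 0 < Δy)
    (hδ : 0 ≤ δ) {n : ℕ} (hΔt : 0 ≤ Δt n) (hρ : ∀ p, 0 ≤ ρ n p)
    (hux : ∀ i j, |vel Δx Δy Fx (ρ n) i j| ≤ f) (huy : ∀ i j, |vel Δx Δy Fy (ρ n) i j| ≤ f)
    {R : ℝ} (hR : ∀ p, ρ n p ≤ R)
    (hCFL : (2 * f * (1 / Δx + 1 / Δy) + δ * R * (1 / Δx ^ 2 + 1 / Δy ^ 2)) * Δt n ≤ 1)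
    (p : ℤ × ℤ) : 0 ≤ ρ (n + 1) p := by
  obtain ⟨i, j⟩ := p
  have hx := directional_update_lower_bound (A := Δt n / Δx) (C := δ * Δt n / Δx ^ 2)
    (by positivity) (by positivity) (hρ (i, j)) (hρ (i + 1, j)) (hρ (i - 1, j))
    (abs_midpoint_le (hux i j) (hux (i + 1) j)) (abs_midpoint_le (hux (i - 1) j) (hux i j))
  have hy := directional_update_lower_bound (A := Δt n / Δy) (C := δ * Δt n / Δy ^ 2)
    (by positivity) (by positivity) (hρ (i, j)) (hρ (i, j + 1)) (hρ (i, j - 1))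
    (abs_midpoint_le (huy i j) (huy i (j + 1))) (abs_midpoint_le (huy i (j - 1)) (huy i j))
  have hCFL' : (2 * f * (1 / Δx + 1 / Δy)
      + δ * ρ n (i, j) * (1 / Δx ^ 2 + 1 / Δy ^ 2)) * Δt n ≤ 1 := by
    refine le_trans ?_ hCFL
    gcongr
    exact hR _
  have hcoef := mul_nonneg (sub_nonneg.2 hCFL') (hρ (i, j))
  rw [hupd n i j]
  ring_nf at hx hy hcoef ⊢
  linarith

/-- Positivity and stability of the finite-volume scheme under the CFL condition
`(2f(1/Δx + 1/Δy) + δ rₙ (1/Δx² + 1/Δy²)) Δtⁿ ≤ 1` with `rₙ = sup_{ij} ρⁿ_{ij}`: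
the scheme stays nonnegative, the velocities are bounded by `f`, and the densities are
uniformly bounded (one may take `r = 1/(ΔxΔy)`). -/
theorem fv_positivity_and_stability
    (Δx Δy f δ : ℝ) (Δt : ℕ → ℝ) (Fx Fy : ℤ × ℤ → ℤ × ℤ → ℝ)
    (ρ : ℕ → ℤ × ℤ → ℝ)
    (hΔx : 0 < Δx) (hΔy : 0 < Δy) (hΔt : ∀ n, 0 < Δt n) (hδ : 0 < δ) (hf : 0 ≤ f)
    (hFx : ∀ p q, |Fx p q| ≤ f * (Δx * Δy) ^ 2)
    (hFy : ∀ p q, |Fy p q| ≤ f * (Δx * Δy) ^ 2)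
    (h0nonneg : ∀ p, 0 ≤ ρ 0 p)
    (hsum : ∀ n, Summable (ρ n))
    (hmass0 : (∑' p : ℤ × ℤ, ρ 0 p * (Δx * Δy)) = 1)
    (hupd : FVUpdate Δx Δy f δ Δt Fx Fy ρ)
    (hCFL : ∀ n, (2 * f * (1 / Δx + 1 / Δy)
        + δ * (⨆ p : ℤ × ℤ, ρ n p) * (1 / Δx ^ 2 + 1 / Δy ^ 2)) * Δt n ≤ 1) :
    (∀ n p, 0 ≤ ρ n p) ∧
    (∀ n i j, |vel Δx Δy Fx (ρ n) i j| ≤ f) ∧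
    (∀ n i j, |vel Δx Δy Fy (ρ n) i j| ≤ f) ∧
    (∀ n p, ρ n p ≤ 1 / (Δx * Δy)) ∧
    (∃ r : ℝ, 0 < r ∧ ∀ n p, ρ n p ≤ r) := by
  have hpos : 0 < Δx * Δy := mul_pos hΔx hΔy
  have le_mass : ∀ {n}, (∀ p, 0 ≤ ρ n p) → HasSum (ρ n) (Δx * Δy)⁻¹ →
      ∀ p, ρ n p ≤ (Δx * Δy)⁻¹ :=
    fun h hm p => le_hasSum hm p fun q _ => h q
  have inv : ∀ n, (∀ p, 0 ≤ ρ n p) ∧ HasSum (ρ n) (Δx * Δy)⁻¹ := by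
    intro n
    induction n with
    | zero =>
      refine ⟨h0nonneg, ?_⟩
      rw [tsum_mul_right] at hmass0
      rw [← eq_inv_of_mul_eq_one_left hmass0]
      exact (hsum 0).hasSum
    | succ n ih =>
      obtain ⟨hρ, hmass⟩ := ih
      have hux := abs_vel_le hΔx hΔy hFx hρ hmass
      have huy := abs_vel_le hΔx hΔy hFy hρ hmass
      have hle := le_mass hρ hmass
      have hbdd : BddAbove (Set.range (ρ n)) := ⟨_, Set.forall_mem_range.2 hle⟩
      exact ⟨hupd.nonneg_succ hΔx hΔy hδ.le (hΔt n).le hρ hux huy (le_ciSup hbdd) (hCFL n),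
        hupd.hasSum_succ hmass (fun p => (abs_of_nonneg (hρ p)).trans_le (hle p)) hux huy⟩
  have bound : ∀ n p, ρ n p ≤ 1 / (Δx * Δy) := fun n p => by
    rw [one_div]
    exact le_mass (inv n).1 (inv n).2 p
  exact ⟨fun n => (inv n).1, fun n => abs_vel_le hΔx hΔy hFx (inv n).1 (inv n).2,
    fun n => abs_vel_le hΔx hΔy hFy (inv n).1 (inv n).2, bound, _, one_div_pos.2 hpos, bound⟩
end
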